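/- arXiv:math-ph/0204039 — 8 statements merged into one kernel-verified Lean document; each statement's English description precedes it below -/
import Mathlib

section
/- Let K be a complex Hilbert space and S a bounded self-adjoint operator on K with 0 ≤ S ≤ 1 such that γ := 2S − 1 is injective. Let D be the set of pairs (h₁, h₂) ∈ K ⊕ K such that both S h₁ + √(S(1−S)) h₂ and √(S(1−S)) h₁ + (1−S) h₂ lie in the range of γ, and for (h₁, h₂) ∈ D define P(h₁, h₂) := ( γ⁻¹(S h₁ + √(S(1−S)) h₂), −γ⁻¹(√(S(1−S)) h₁ + (1−S) h₂) ). Then P maps D into D, and P(P(h₁,h₂)) = P(h₁,h₂) for all (h₁,h₂) ∈ D; i.e. P is idempotent on its natural domain. (This is the computational core of the paper's Lemma asserting that P_S is a basis projection.) -/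
open scoped InnerProductSpace

/-- **The map `P_S` is idempotent on its natural domain** (computational core of the
lemma that `P_S` is a basis projection).  Here `S` is a bounded self-adjoint operator
with `0 ≤ S ≤ 1`, `R = √(S(1-S))` is the positive square root of `S(1-S)`,
`γ = 2S - 1` is injective, the domain `D` consists of the pairs `(h₁, h₂)` for which
both `S h₁ + R h₂` and `R h₁ + (1-S) h₂` lie in the range of `γ`, and
`P (h₁, h₂) = (γ⁻¹(S h₁ + R h₂), -γ⁻¹(R h₁ + (1-S) h₂))`, where `γ⁻¹` is the inverse
of `γ` on its range. -/
theorem basisProjection_idempotent_on_domain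
    {K : Type*} [NormedAddCommGroup K] [InnerProductSpace ℂ K] [CompleteSpace K]
    (S : K →L[ℂ] K) (hS : S.IsPositive) (hS1 : (1 - S).IsPositive)
    (R : K →L[ℂ] K) (hR : R.IsPositive) (hR2 : R * R = S * (1 - S))
    (γ : K →L[ℂ] K) (hγ : γ = 2 • S - 1) (hγinj : Function.Injective γ)
    (D : Set (K × K))
    (hD : D = {p : K × K | (S p.1 + R p.2) ∈ Set.range γ ∧
      (R p.1 + (1 - S) p.2) ∈ Set.range γ})
    (P : K × K → K × K)
    (hP : ∀ p : K × K,
      P p = (Function.invFun γ (S p.1 + R p.2), -Function.invFun γ (R p.1 + (1 - S) p.2))) :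
    ∀ p ∈ D, P p ∈ D ∧ P (P p) = P p := by
  have hc : Commute R S := by
    have hR0 : 0 ≤ R := (ContinuousLinearMap.nonneg_iff_isPositive R).2 hR
    have h1 : Commute (R * R) S := by
      rw [hR2]
      exact (Commute.refl S).mul_left ((Commute.one_left S).sub_left (Commute.refl S))
    have h2 : CFC.sqrt (R * R) = R := CFC.sqrt_mul_self R hR0
    rw [← h2]
    exact h1.cfcₙ_nnreal _
  have hRS : ∀ x, R (S x) = S (R x) := fun x => DFunLike.congr_fun hc.eq x
  have hRR : ∀ x, R (R x) = S x - S (S x) := fun x => by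
    have := DFunLike.congr_fun hR2 x
    simpa using this
  have hg : ∀ x, γ x = S x + S x - x := fun x => by
    rw [hγ]; simp [two_smul]
  have hinv : ∀ x, Function.invFun γ (γ x) = x := Function.leftInverse_invFun hγinj
  rintro ⟨a, b⟩ hp
  rw [hD] at hp
  obtain ⟨⟨u, hu⟩, ⟨v, hv⟩⟩ := hp
  have hPp : P (a, b) = (u, -v) := by rw [hP, ← hu, ← hv, hinv, hinv]
  simp only at hu hv
  have hSγ : ∀ x, γ (S x) = S (γ x) := fun x => by simp [hg]
  have hRγ : ∀ x, γ (R x) = R (γ x) := fun x => by simp [hg, hRS]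
  have e1 : S u + R (-v) = γ u := by
    apply hγinj
    rw [map_add, hSγ, hRγ, map_neg, hu, hv]
    simp [hg, hRS, hRR]
    abel
  have e2 : R u + (1 - S) (-v) = γ v := by
    apply hγinj
    have : R u + (1 - S) (-v) = R u - v + S v := by simp; abel
    rw [this, map_add, map_sub, hSγ, hRγ, hu, hv]
    simp [hg, hRS, hRR]
    abel
  rw [hPp]
  refine ⟨?_, ?_⟩
  · rw [hD]; exact ⟨⟨u, e1.symm⟩, ⟨v, e2.symm⟩⟩
  · rw [hP]; simp only; rw [e1, e2, hinv, hinv]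
end

section
/- Let K be a complex Hilbert space and S a bounded self-adjoint operator on K with 0 ≤ S ≤ 1. Then the bounded operator M on the Hilbert space direct sum K ⊕ K given in block form by M(f, g) := ( S f + √(S(1−S)) g , √(S(1−S)) f + (1−S) g ) is an orthogonal projection: M is self-adjoint and M ∘ M = M. (This operator matrix underlies the positive semi-definite form P_S((f₁,g₁),(f₂,g₂)) = (f₁, S f₂ + √(S(1−S)) g₂) + (g₁, √(S(1−S)) f₂ + (1−S) g₂) used to define the doubled quasifree state.) -/
/-- **The block operator matrix `(S, √(S(1-S)); √(S(1-S)), 1-S)` is an orthogonal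
projection on `K ⊕ K`.**  Here `S` is a bounded self-adjoint operator on a complex
Hilbert space `K` with `0 ≤ S ≤ 1`, `R = √(S(1-S))` is the positive square root of
`S(1-S)`, and `K ⊕ K` carries the direct-sum (`L²`) inner product. -/
theorem block_operator_is_orthogonal_projection
    {K : Type*} [NormedAddCommGroup K] [InnerProductSpace ℂ K] [CompleteSpace K]
    (S : K →L[ℂ] K) (hS : S.IsPositive) (hS1 : (1 - S).IsPositive)
    (R : K →L[ℂ] K) (hR : R.IsPositive) (hR2 : R * R = S * (1 - S))
    (M : WithLp 2 (K × K) →L[ℂ] WithLp 2 (K × K))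
    (hM : ∀ p : WithLp 2 (K × K),
      M p = (WithLp.equiv 2 (K × K)).symm
        (S ((WithLp.equiv 2 (K × K)) p).1 + R ((WithLp.equiv 2 (K × K)) p).2,
         R ((WithLp.equiv 2 (K × K)) p).1 + (1 - S) ((WithLp.equiv 2 (K × K)) p).2)) :
    IsSelfAdjoint M ∧ M ∘L M = M := by
  have hcomm : Commute R S := by
    have h1 : Commute (S * (1 - S)) S := by
      change S * (1 - S) * S = S * (S * (1 - S))
      noncomm_ring
    have h2 : CFC.sqrt (S * (1 - S)) = R :=
      CFC.sqrt_unique hR2 ((ContinuousLinearMap.nonneg_iff_isPositive R).2 hR)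
    rw [← h2]
    exact Commute.cfcₙ_nnreal h1 _
  have hRS : ∀ x, R (S x) = S (R x) := fun x => DFunLike.congr_fun hcomm.eq x
  have hRR : ∀ x, R (R x) = S x - S (S x) := fun x => by
    have h := DFunLike.congr_fun hR2 x
    simpa using h
  have sS : ∀ x y, inner ℂ (S x) y = inner ℂ x (S y) := hS.isSymmetric
  have sR : ∀ x y, inner ℂ (R x) y = inner ℂ x (R y) := hR.isSymmetric
  constructor
  · rw [ContinuousLinearMap.isSelfAdjoint_iff_isSymmetric]
    intro x y
    simp only [ContinuousLinearMap.coe_coe, hM, WithLp.prod_inner_apply]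
    simp [inner_add_left, inner_add_right, inner_sub_left, inner_sub_right, sS, sR]
    ring
  · ext p
    all_goals
      simp [hM, hRS, hRR]
      try abel
end

section
/- Let L be a complex inner product space, N ≥ 1, and u₁, …, u_N ∈ L such that for all i ≠ j one has u_i ≠ u_j and u_i ≠ −u_j. If complex numbers α₁, …, α_N satisfy Σ_{j=1}^N α_j · cosh(⟨x, u_j⟩) = 0 for every x ∈ L, then α_j = 0 for all j. (This expresses the linear independence of the even exponential vectors e⁺(u₁), …, e⁺(u_N) in the even part of the Boson Fock space, since ⟨e⁺(x), e⁺(u)⟩ = cosh⟨x, u⟩.) -/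
open scoped InnerProductSpace

/-- The exponential character `x ↦ exp ⟪x, v⟫`. -/
noncomputable def expChar {L : Type*} [NormedAddCommGroup L] [InnerProductSpace ℂ L] (v : L) :
    Multiplicative L →* ℂ where
  toFun x := Complex.exp (⟪x.toAdd, v⟫_ℂ)
  map_one' := by simp
  map_mul' x y := by simp [inner_add_left, Complex.exp_add]

theorem expChar_injective {L : Type*} [NormedAddCommGroup L] [InnerProductSpace ℂ L] :
    Function.Injective (expChar : L → (Multiplicative L →* ℂ)) := by
  intro v w hvw
  by_contra hne
  have hd : v - w ≠ 0 := sub_ne_zero.mpr hne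
  have hi : ⟪v - w, v - w⟫_ℂ ≠ 0 := inner_self_ne_zero.mpr hd
  have h1 := DFunLike.congr_fun hvw (Multiplicative.ofAdd
    ((starRingEnd ℂ) (⟪v - w, v - w⟫_ℂ)⁻¹ • (v - w)))
  simp only [expChar, MonoidHom.coe_mk, OneHom.coe_mk, toAdd_ofAdd, inner_smul_left,
    Complex.conj_conj] at h1
  have h2 : ⟪v - w, v⟫_ℂ = ⟪v - w, w⟫_ℂ + ⟪v - w, v - w⟫_ℂ := by
    rw [← inner_add_right]; congr 1; abel
  rw [h2, mul_add, inv_mul_cancel₀ hi, Complex.exp_add] at h1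
  have h3 : Complex.exp 1 = 1 := by
    have := Complex.exp_ne_zero ((⟪v - w, v - w⟫_ℂ)⁻¹ * ⟪v - w, w⟫_ℂ)
    exact mul_left_cancel₀ this (by rw [h1, mul_one])
  have h4 : Real.exp 1 = 1 := by
    apply Complex.ofReal_injective
    rw [Complex.ofReal_exp, Complex.ofReal_one, h3]
  simp at h4

/-- **Linear independence of even exponential vectors.**
If `u₁, …, u_N` in a complex inner product space satisfy `uᵢ ≠ ±uⱼ` for `i ≠ j`, and
`∑ⱼ αⱼ cosh ⟪x, uⱼ⟫ = 0` for every `x`, then all `αⱼ = 0`. -/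
theorem even_exponential_vectors_linearly_independent
    {L : Type*} [NormedAddCommGroup L] [InnerProductSpace ℂ L]
    (N : ℕ) (hN : 1 ≤ N) (u : Fin N → L)
    (hu : ∀ i j : Fin N, i ≠ j → u i ≠ u j ∧ u i ≠ -u j)
    (α : Fin N → ℂ)
    (h : ∀ x : L, ∑ j : Fin N, α j * Complex.cosh (⟪x, u j⟫_ℂ) = 0) :
    ∀ j : Fin N, α j = 0 := by
  classical
  intro i
  have hli := (linearIndependent_monoidHom (Multiplicative L) ℂ).comp _
    (expChar_injective (L := L))
  rw [linearIndependent_iff] at hli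
  have hF := hli (∑ j, (Finsupp.single (u j) (α j) + Finsupp.single (-u j) (α j))) (by
    funext x
    simp only [map_sum, map_add, Finsupp.linearCombination_single, Finset.sum_apply,
      Pi.add_apply, Pi.smul_apply, Function.comp, expChar, MonoidHom.coe_mk, OneHom.coe_mk,
      smul_eq_mul, inner_neg_right, Pi.zero_apply]
    have := congrArg (fun z => 2 * z) (h x.toAdd)
    simp only [mul_zero, Finset.mul_sum] at this
    rw [← this]
    refine Finset.sum_congr rfl fun j _ => ?_
    rw [Complex.cosh]; ring)
  have hE := DFunLike.congr_fun hF (u i)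
  rw [Finsupp.finsetSum_apply, Finset.sum_eq_single i] at hE
  · simp only [Finsupp.add_apply, Finsupp.single_apply, if_true, Finsupp.zero_apply] at hE
    split_ifs at hE
    · linear_combination hE / 2
    · simpa using hE
  · intro j _ hj
    obtain ⟨h1, h2⟩ := hu i j (Ne.symm hj)
    simp [Finsupp.single_apply, h1.symm, h2.symm]
  · simp
end

section
/- Let (K, γ, Γ) be a self-dual structure. Then for every finite-dimensional complex subspace K₁ of K there exists a finite-dimensional complex subspace K₁^# of K such that K₁ ⊆ K₁^#, Γ maps K₁^# into K₁^#, and the restriction of γ to K₁^# × K₁^# is nondegenerate (i.e. if f ∈ K₁^# and γ(f,g) = 0 for all g ∈ K₁^#, then f = 0). -/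
/-- The radical of `γ` restricted to `W`. -/
def gammaRad {K : Type*} [AddCommGroup K] [Module ℂ K]
    (γ : K →ₗ⋆[ℂ] K →ₗ[ℂ] ℂ) (W : Submodule ℂ K) : Submodule ℂ K where
  carrier := {f | f ∈ W ∧ ∀ g ∈ W, γ f g = 0}
  zero_mem' := ⟨W.zero_mem, fun g _ => by simp⟩
  add_mem' := fun {a b} ha hb => ⟨W.add_mem ha.1 hb.1, fun g hg => by
    simp [ha.2 g hg, hb.2 g hg]⟩
  smul_mem' := fun c a ha => ⟨W.smul_mem c ha.1, fun g hg => by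
    simp [ha.2 g hg]⟩

theorem gamma_step {K : Type*} [AddCommGroup K] [Module ℂ K]
    (γ : K →ₗ⋆[ℂ] K →ₗ[ℂ] ℂ)
    (hherm : ∀ f g : K, γ g f = starRingEnd ℂ (γ f g))
    (hnondeg : ∀ f : K, (∀ g : K, γ f g = 0) → f = 0)
    (Γ : K →ₗ⋆[ℂ] K) (hΓΓ : ∀ f : K, Γ (Γ f) = f) (n : ℕ) :
    ∀ W : Submodule ℂ K, FiniteDimensional ℂ W → (∀ f ∈ W, Γ f ∈ W) →
      Module.finrank ℂ (gammaRad γ W) = n →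
    ∃ K₂ : Submodule ℂ K, FiniteDimensional ℂ K₂ ∧ W ≤ K₂ ∧
      (∀ f ∈ K₂, Γ f ∈ K₂) ∧
      (∀ f ∈ K₂, (∀ g ∈ K₂, γ f g = 0) → f = 0) := by
  induction n using Nat.strong_induction_on with
  | _ n ih =>
    intro W hW hinv hn
    by_cases hdone : ∀ f ∈ W, (∀ g ∈ W, γ f g = 0) → f = 0
    · exact ⟨W, hW, le_rfl, hinv, hdone⟩
    push Not at hdone
    obtain ⟨r, hrW, hr, hr0⟩ := hdone
    have hg : ∃ g, Γ g = g ∧ γ r g ≠ 0 := by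
      by_contra! hcon
      apply hr0
      apply hnondeg
      intro g
      have h1 := hcon (g + Γ g) (by rw [map_add, hΓΓ, add_comm])
      have h2 := hcon (Complex.I • (g - Γ g)) (by
        rw [LinearMap.map_smulₛₗ, map_sub, hΓΓ, Complex.conj_I, neg_smul, ← smul_neg, neg_sub])
      rw [map_smul, smul_eq_mul, map_sub] at h2
      have h3 := (mul_eq_zero.mp h2).resolve_left Complex.I_ne_zero
      rw [map_add] at h1
      have h4 : 2 * γ r g = 0 := by linear_combination h1 + h3
      simpa using h4
    obtain ⟨g, hgr, hrg⟩ := hg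
    have hgW : g ∈ W ⊔ Submodule.span ℂ {g} :=
      Submodule.mem_sup_right (Submodule.mem_span_singleton_self g)
    have hlt : gammaRad γ (W ⊔ Submodule.span ℂ {g}) < gammaRad γ W := by
      refine lt_of_le_of_ne ?_ ?_
      · rintro f ⟨hf, hf0⟩
        obtain ⟨w, hw, y, hy, rfl⟩ := Submodule.mem_sup.mp hf
        obtain ⟨c, rfl⟩ := Submodule.mem_span_singleton.mp hy
        have h1 := hf0 r (Submodule.mem_sup_left hrW)
        have h2 : γ w r = 0 := by rw [hherm r w, hr w hw, map_zero]
        have h3 : γ g r ≠ 0 := by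
          rw [hherm r g]; simpa using hrg
        have hc : c = 0 := by
          simpa [h2, h3] using h1
        subst hc
        rw [zero_smul, add_zero] at hf0 ⊢
        exact ⟨hw, fun x hx => hf0 x (Submodule.mem_sup_left hx)⟩
      · intro heq
        have hmem : r ∈ gammaRad γ W := ⟨hrW, hr⟩
        rw [← heq] at hmem
        exact hrg (hmem.2 g hgW)
    have hfd : FiniteDimensional ℂ (gammaRad γ W) :=
      Submodule.finiteDimensional_of_le (S₂ := W) (fun f hf => hf.1)
    obtain ⟨K₂, h1, h2, h3⟩ := ih _ (hn ▸ Submodule.finrank_lt_finrank_of_lt hlt)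
      (W ⊔ Submodule.span ℂ {g}) inferInstance (by
        intro f hf
        obtain ⟨w, hw, y, hy, rfl⟩ := Submodule.mem_sup.mp hf
        obtain ⟨c, rfl⟩ := Submodule.mem_span_singleton.mp hy
        rw [map_add, LinearMap.map_smulₛₗ, hgr]
        exact Submodule.add_mem _ (Submodule.mem_sup_left (hinv w hw))
          (Submodule.smul_mem _ _ hgW)) rfl
    exact ⟨K₂, h1, le_sup_left.trans h2, h3⟩

/-- **Existence of finite-dimensional self-dual nondegenerate enlargements.**
Let `(K, γ, Γ)` be a self-dual structure: `γ` is a nondegenerate hermitian sesquilinear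
form (conjugate-linear in the first variable) and `Γ` is a conjugate-linear involution
with `γ (Γ f) (Γ g) = -γ g f`.  Then every finite-dimensional subspace `K₁` of `K` is
contained in a finite-dimensional `Γ`-invariant subspace `K₁^#` on which `γ` restricts
to a nondegenerate form. -/
theorem exists_finiteDimensional_gammaInvariant_nondegenerate_enlargement
    {K : Type*} [AddCommGroup K] [Module ℂ K]
    (γ : K →ₗ⋆[ℂ] K →ₗ[ℂ] ℂ)
    (hherm : ∀ f g : K, γ g f = starRingEnd ℂ (γ f g))
    (hnondeg : ∀ f : K, (∀ g : K, γ f g = 0) → f = 0)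
    (Γ : K →ₗ⋆[ℂ] K) (hΓΓ : ∀ f : K, Γ (Γ f) = f)
    (hγΓ : ∀ f g : K, γ (Γ f) (Γ g) = -γ g f)
    (K₁ : Submodule ℂ K) (hK₁ : FiniteDimensional ℂ K₁) :
    ∃ K₂ : Submodule ℂ K, FiniteDimensional ℂ K₂ ∧ K₁ ≤ K₂ ∧
      (∀ f ∈ K₂, Γ f ∈ K₂) ∧
      (∀ f ∈ K₂, (∀ g ∈ K₂, γ f g = 0) → f = 0) := by
  have hfd : FiniteDimensional ℂ (K₁.map Γ) := by
    have := (Submodule.fg_top K₁).mp hK₁.fg_top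
    exact Module.Finite.iff_fg.mpr (this.map Γ)
  obtain ⟨K₂, h1, h2, h3⟩ := gamma_step γ hherm hnondeg Γ hΓΓ _ (K₁ ⊔ K₁.map Γ)
    inferInstance (by
      intro f hf
      obtain ⟨w, hw, y, hy, rfl⟩ := Submodule.mem_sup.mp hf
      obtain ⟨z, hz, rfl⟩ := Submodule.mem_map.mp hy
      rw [map_add, hΓΓ]
      exact Submodule.add_mem _ (Submodule.mem_sup_right (Submodule.mem_map_of_mem hw))
        (Submodule.mem_sup_left hz)) rfl
  exact ⟨K₂, h1, le_sup_left.trans h2, h3⟩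
end

section
/- Let K be a complex Hilbert space, Γ an antiunitary involution on K, and P an orthogonal projection on K with ΓPΓ = 1 − P. If (e_n)_{n ∈ ι} is an orthonormal basis of the closed subspace P K (the range of P), then the combined family (e_n)_{n ∈ ι} together with (Γ e_n)_{n ∈ ι} is an orthonormal basis of K. -/
open scoped InnerProductSpace

/-- **An orthonormal basis of `PK` together with its `Γ`-image is an orthonormal basis
of `K`.**  Here `Γ` is an antiunitary involution on the complex Hilbert space `K` and
`P` is an orthogonal projection with `Γ P Γ = 1 - P`. -/
theorem basis_of_range_with_gamma_image_is_basis
    {K : Type*} [NormedAddCommGroup K] [InnerProductSpace ℂ K] [CompleteSpace K]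
    (Γ : K →ₗ⋆[ℂ] K) (hΓΓ : ∀ f : K, Γ (Γ f) = f)
    (hΓinner : ∀ f g : K, ⟪Γ f, Γ g⟫_ℂ = ⟪g, f⟫_ℂ)
    (P : K →L[ℂ] K) (hPidem : IsIdempotentElem P) (hPsa : IsSelfAdjoint P)
    (hΓP : ∀ f : K, Γ (P (Γ f)) = f - P f)
    {ι : Type*} (e : ι → K)
    (he : Orthonormal ℂ e)
    (hmem : ∀ n : ι, e n ∈ LinearMap.range (P : K →ₗ[ℂ] K))
    (hspan : (Submodule.span ℂ (Set.range e)).topologicalClosure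
      = LinearMap.range (P : K →ₗ[ℂ] K)) :
    Orthonormal ℂ (Sum.elim e fun n : ι => Γ (e n)) ∧
      (Submodule.span ℂ (Set.range (Sum.elim e fun n : ι => Γ (e n)))).topologicalClosure
        = ⊤ := by
  have hsym : ∀ x y : K, ⟪P x, y⟫_ℂ = ⟪x, P y⟫_ℂ := fun x y => hPsa.isSymmetric x y
  have hPP : ∀ x : K, P (P x) = P x := fun x => by
    have h := congrArg (fun T : K →L[ℂ] K => T x) hPidem.eq
    simpa using h
  have hPe : ∀ n, P (e n) = e n := fun n => by
    obtain ⟨x, hx⟩ := hmem n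
    have hx' : P x = e n := hx
    rw [← hx', hPP]
  have hPΓe : ∀ n, P (Γ (e n)) = 0 := fun n => by
    have h := hΓP (Γ (e n))
    rw [hΓΓ, hPe] at h
    exact sub_eq_self.mp h.symm
  have horth : ∀ m n, ⟪e m, Γ (e n)⟫_ℂ = 0 := fun m n => by
    rw [← hPe m, hsym, hPΓe, inner_zero_right]
  have hker : ∀ f : K, (∀ n, ⟪e n, f⟫_ℂ = 0) → P f = 0 := fun f hf => by
    have h1 : f ∈ (Submodule.span ℂ (Set.range e))ᗮ := by
      rw [Submodule.mem_orthogonal]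
      intro u hu
      induction hu using Submodule.span_induction with
      | mem x hx =>
        obtain ⟨n, rfl⟩ := hx
        exact hf n
      | zero => exact inner_zero_left _
      | add x y _ _ hx hy => rw [inner_add_left, hx, hy, add_zero]
      | smul a x _ hx => rw [inner_smul_left, hx, mul_zero]
    rw [← Submodule.orthogonal_closure, hspan, Submodule.mem_orthogonal] at h1
    have h2 : ⟪P (P f), f⟫_ℂ = 0 := h1 _ ⟨P f, rfl⟩
    rw [hsym] at h2
    exact inner_self_eq_zero.mp h2
  refine ⟨⟨?_, ?_⟩, ?_⟩
  · rintro (n | n)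
    · exact he.1 n
    · have h := hΓinner (e n) (e n)
      rw [inner_self_eq_norm_sq_to_K, inner_self_eq_norm_sq_to_K, he.1 n] at h
      have h' : ‖Γ (e n)‖ ^ 2 = 1 := by
        have h3 : ((‖Γ (e n)‖ ^ 2 : ℝ) : ℂ) = ((1 : ℝ) : ℂ) := by simpa using h
        exact_mod_cast h3
      exact (pow_eq_one_iff_of_nonneg (norm_nonneg _) two_ne_zero).mp h'
  · rintro (m | m) (n | n) hmn
    · exact he.2 (fun h => hmn (by rw [h]))
    · exact horth m n
    · exact inner_eq_zero_symm.mp (horth n m)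
    · change ⟪Γ (e m), Γ (e n)⟫_ℂ = 0
      rw [hΓinner]
      exact he.2 (fun h => hmn (by rw [h]))
  · rw [Submodule.topologicalClosure_eq_top_iff, Submodule.eq_bot_iff]
    intro f hf
    rw [Submodule.mem_orthogonal] at hf
    have h1 : P f = 0 := hker f fun n => hf _ (Submodule.subset_span ⟨Sum.inl n, rfl⟩)
    have h2 : P (Γ f) = 0 := hker (Γ f) fun n => by
      have h3 : ⟪Γ (e n), f⟫_ℂ = 0 := hf _ (Submodule.subset_span ⟨Sum.inr n, rfl⟩)
      rw [← hΓinner, hΓΓ]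
      exact inner_eq_zero_symm.mp h3
    have h4 := hΓP f
    rw [h1, h2, map_zero, sub_zero] at h4
    exact h4.symm
end

section
/- Let K be a complex Hilbert space, Γ an antiunitary involution on K, P an orthogonal projection on K with ΓPΓ = 1 − P, J := 2P − 1, γ(f,g) := ⟨f, Jg⟩, and let Sp(∞,P) be the set of bounded invertible operators U on K with γ(Uf,Ug) = γ(f,g) for all f,g, UΓ = ΓU, and PU(1−P) Hilbert–Schmidt. Then Sp(∞,P) is a group under composition (closed under products and inverses), and it is a topological group with respect to the metric d_P(A,B) := ‖A − B‖ + ‖P(A − B)(1−P)‖_HS: if d_P(A_ν, A) → 0 and d_P(B_ν, B) → 0 with all operators in Sp(∞,P), then d_P(A_ν B_ν, AB) → 0 and d_P(A_ν⁻¹, A⁻¹) → 0. -/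
open scoped ENNReal InnerProductSpace
open Filter

/-- The Hilbert–Schmidt norm of an operator, computed with respect to a Hilbert basis
`b` (the value is independent of the choice of basis). -/
noncomputable def hsNorm {K : Type*} [NormedAddCommGroup K] [InnerProductSpace ℂ K]
    [CompleteSpace K] {ι : Type*} (b : HilbertBasis ι ℂ K) (T : K →L[ℂ] K) : ℝ≥0∞ :=
  (∑' i : ι, (‖T (b i)‖₊ : ℝ≥0∞) ^ 2) ^ (1 / 2 : ℝ)

/-- The distance `d_P(A,B) = ‖A - B‖ + ‖P (A - B) (1 - P)‖_HS` on `Sp(∞, P)`. -/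
noncomputable def dP {K : Type*} [NormedAddCommGroup K] [InnerProductSpace ℂ K]
    [CompleteSpace K] {ι : Type*} (b : HilbertBasis ι ℂ K) (P : K →L[ℂ] K)
    (A B : K →L[ℂ] K) : ℝ≥0∞ :=
  (‖A - B‖₊ : ℝ≥0∞) + hsNorm b (P ∘L (A - B) ∘L (1 - P))

/-- Membership in `Sp(∞, P)`: a bounded invertible operator preserving the form
`γ(f,g) = ⟪f, (2P-1) g⟫`, commuting with `Γ`, and with `P U (1-P)` Hilbert–Schmidt. -/
def InSp {K : Type*} [NormedAddCommGroup K] [InnerProductSpace ℂ K] [CompleteSpace K]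
    {ι : Type*} (b : HilbertBasis ι ℂ K) (P : K →L[ℂ] K) (Γ : K →ₗ⋆[ℂ] K)
    (U : K ≃L[ℂ] K) : Prop :=
  (∀ f g : K, ⟪U f, (2 • P - 1 : K →L[ℂ] K) (U g)⟫_ℂ = ⟪f, (2 • P - 1 : K →L[ℂ] K) g⟫_ℂ) ∧
  (∀ f : K, U (Γ f) = Γ (U f)) ∧
  hsNorm b (P ∘L (U : K →L[ℂ] K) ∘L (1 - P)) < ⊤


section SpAux
variable {K : Type*} [NormedAddCommGroup K] [InnerProductSpace ℂ K] [CompleteSpace K]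
    {ι : Type*}

/-- Squared Hilbert–Schmidt norm. -/
noncomputable def hsSq (b : HilbertBasis ι ℂ K) (T : K →L[ℂ] K) : ℝ≥0∞ :=
  ∑' i : ι, ‖T (b i)‖ₑ ^ 2

theorem hsNorm_eq (b : HilbertBasis ι ℂ K) (T : K →L[ℂ] K) :
    hsNorm b T = (hsSq b T) ^ (1 / 2 : ℝ) := rfl

theorem parseval_enorm (b : HilbertBasis ι ℂ K) (x : K) :
    ∑' i, ‖⟪b i, x⟫_ℂ‖ₑ ^ 2 = ‖x‖ₑ ^ 2 := by
  have h := (b.hasSum_inner_mul_inner x x).mapL Complex.reCLM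
  have h2 : HasSum (fun i => ‖⟪b i, x⟫_ℂ‖ ^ 2) (‖x‖ ^ 2) := by
    convert h using 1
    · funext i
      rw [← inner_conj_symm x (b i), ← Complex.normSq_eq_conj_mul_self]
      simp [Complex.normSq_eq_norm_sq, ← Complex.ofReal_pow]
    · rw [inner_self_eq_norm_sq_to_K]
      simp [← Complex.ofReal_pow]
  have h3 := ENNReal.ofReal_tsum_of_nonneg (fun i => by positivity) h2.summable
  rw [h2.tsum_eq] at h3
  simpa [ENNReal.ofReal_pow, ofReal_norm] using h3.symm

/-- Hilbert–Schmidt norm via double sums. -/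
theorem hsSq_adjoint (b : HilbertBasis ι ℂ K) (T : K →L[ℂ] K) :
    hsSq b (ContinuousLinearMap.adjoint T) = hsSq b T := by
  unfold hsSq
  simp_rw [← parseval_enorm b]
  rw [ENNReal.tsum_comm]
  refine tsum_congr fun i => tsum_congr fun j => ?_
  rw [ContinuousLinearMap.adjoint_inner_right]
  simp only [← ofReal_norm]
  rw [norm_inner_symm]

theorem hsSq_comp_left (b : HilbertBasis ι ℂ K) (S T : K →L[ℂ] K) :
    hsSq b (S ∘L T) ≤ ‖S‖ₑ ^ 2 * hsSq b T := by
  unfold hsSq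
  rw [← ENNReal.tsum_mul_left]
  refine ENNReal.tsum_le_tsum fun i => ?_
  rw [← mul_pow]
  gcongr
  exact S.le_opENorm _

theorem hsSq_comp_right (b : HilbertBasis ι ℂ K) (T S : K →L[ℂ] K) :
    hsSq b (T ∘L S) ≤ ‖S‖ₑ ^ 2 * hsSq b T := by
  rw [← hsSq_adjoint b (T ∘L S), ← hsSq_adjoint b T, ContinuousLinearMap.adjoint_comp]
  refine (hsSq_comp_left b _ _).trans_eq ?_
  congr 2
  simp [enorm_eq_nnnorm, ← NNReal.coe_inj]

theorem enorm_add_sq {E : Type*} [NormedAddCommGroup E] (x y : E) :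
    ‖x + y‖ₑ ^ 2 ≤ 2 * (‖x‖ₑ ^ 2 + ‖y‖ₑ ^ 2) := by
  simp only [enorm_eq_nnnorm]
  norm_cast
  rw [← NNReal.coe_le_coe]
  push_cast
  have := norm_add_le x y
  have h0 := norm_nonneg (x + y)
  nlinarith [sq_nonneg (‖x‖ - ‖y‖)]

theorem hsSq_add (b : HilbertBasis ι ℂ K) (S T : K →L[ℂ] K) :
    hsSq b (S + T) ≤ 2 * (hsSq b S + hsSq b T) := by
  unfold hsSq
  rw [← ENNReal.tsum_add, ← ENNReal.tsum_mul_left]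
  exact ENNReal.tsum_le_tsum fun i => enorm_add_sq _ _

theorem hsSq_neg (b : HilbertBasis ι ℂ K) (T : K →L[ℂ] K) :
    hsSq b (-T) = hsSq b T := by
  simp [hsSq]

/-- If `S = Γ T Γ` then `S` has the same Hilbert–Schmidt norm as `T*`. -/
theorem hsSq_conj (b : HilbertBasis ι ℂ K) (Γ : K →ₗ⋆[ℂ] K) (hΓΓ : ∀ f : K, Γ (Γ f) = f)
    (hΓinner : ∀ f g : K, ⟪Γ f, Γ g⟫_ℂ = ⟪g, f⟫_ℂ) (S T : K →L[ℂ] K)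
    (h : ∀ f, S f = Γ (T (Γ f))) : hsSq b S = hsSq b T := by
  have hn : ∀ f, ‖Γ f‖ₑ = ‖f‖ₑ := by
    intro f
    have h1 := hΓinner f f
    rw [inner_self_eq_norm_sq_to_K, inner_self_eq_norm_sq_to_K] at h1
    have h2 : ‖Γ f‖ ^ 2 = ‖f‖ ^ 2 := by exact_mod_cast h1
    have h3 : ‖Γ f‖ = ‖f‖ := by
      rwa [sq_eq_sq₀ (norm_nonneg _) (norm_nonneg _)] at h2
    rw [← ofReal_norm, ← ofReal_norm, h3]
  rw [← hsSq_adjoint b T]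
  unfold hsSq
  simp_rw [h, hn]
  have e2 : ∀ f, ‖f‖ₑ ^ 2 = ∑' i, ‖⟪b i, Γ f⟫_ℂ‖ₑ ^ 2 := fun f => by
    rw [parseval_enorm, hn]
  rw [tsum_congr fun i => (parseval_enorm b (T (Γ (b i)))).symm,
    tsum_congr fun i => e2 (ContinuousLinearMap.adjoint T (b i)), ENNReal.tsum_comm]
  refine tsum_congr fun j => tsum_congr fun i => ?_
  have := hΓinner (Γ (b i)) (ContinuousLinearMap.adjoint T (b j))
  rw [hΓΓ] at this
  rw [this, ContinuousLinearMap.adjoint_inner_left]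

/-- The squared size controlling `d_P`. -/
noncomputable def nP (b : HilbertBasis ι ℂ K) (P : K →L[ℂ] K) (X : K →L[ℂ] K) : ℝ≥0∞ :=
  ‖X‖ₑ ^ 2 + hsSq b (P ∘L X ∘L (1 - P))

theorem nP_add (b : HilbertBasis ι ℂ K) (P X Y : K →L[ℂ] K) :
    nP b P (X + Y) ≤ 2 * (nP b P X + nP b P Y) := by
  unfold nP
  have e : P ∘L (X + Y) ∘L (1 - P) = P ∘L X ∘L (1 - P) + P ∘L Y ∘L (1 - P) := by
    ext f; simp; abel
  rw [e]
  refine (add_le_add (enorm_add_sq X Y) (hsSq_add b _ _)).trans_eq ?_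
  ring

theorem enorm_comp_sq (X Y : K →L[ℂ] K) : ‖X ∘L Y‖ₑ ^ 2 ≤ ‖X‖ₑ ^ 2 * ‖Y‖ₑ ^ 2 := by
  rw [← mul_pow]
  gcongr
  simp only [enorm_eq_nnnorm]
  exact_mod_cast X.opNorm_comp_le Y

/-- The constant in submultiplicativity. -/
noncomputable def cP (P : K →L[ℂ] K) : ℝ≥0∞ := 1 + 2 * (‖P‖ₑ ^ 2 + ‖(1 - P : K →L[ℂ] K)‖ₑ ^ 2)

theorem cP_ne_top (P : K →L[ℂ] K) : cP P ≠ ⊤ := by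
  unfold cP
  finiteness

theorem nP_mul (b : HilbertBasis ι ℂ K) (P : K →L[ℂ] K) (hP : IsIdempotentElem P)
    (X Y : K →L[ℂ] K) :
    nP b P (X ∘L Y) ≤ cP P * (nP b P X * nP b P Y) := by
  have hPP : ∀ f, P (P f) = P f := fun f => congrArg (fun T : K →L[ℂ] K => T f) hP
  have e : P ∘L (X ∘L Y) ∘L (1 - P) = (P ∘L X) ∘L (P ∘L Y ∘L (1 - P))
      + (P ∘L X ∘L (1 - P)) ∘L (Y ∘L (1 - P)) := by
    ext f; simp; abel
  unfold nP
  rw [e]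
  set x := ‖X‖ₑ ^ 2
  set y := ‖Y‖ₑ ^ 2
  set hx := hsSq b (P ∘L X ∘L (1 - P))
  set hy := hsSq b (P ∘L Y ∘L (1 - P))
  have h1 : ‖X ∘L Y‖ₑ ^ 2 ≤ x * y := enorm_comp_sq X Y
  have h2 := hsSq_comp_left b (P ∘L X) (P ∘L Y ∘L (1 - P))
  have h3 := hsSq_comp_right b (P ∘L X ∘L (1 - P)) (Y ∘L (1 - P))
  have h4 := enorm_comp_sq P X
  have h5 := enorm_comp_sq Y (1 - P)
  have h6 := hsSq_add b ((P ∘L X) ∘L (P ∘L Y ∘L (1 - P)))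
    ((P ∘L X ∘L (1 - P)) ∘L (Y ∘L (1 - P)))
  set p := ‖P‖ₑ ^ 2 with hp
  set q := ‖(1 - P : K →L[ℂ] K)‖ₑ ^ 2 with hq
  have hc : cP P = 1 + 2 * (p + q) := rfl
  calc _ ≤ x * y + 2 * ((p * x) * hy + (y * q) * hx) := by
        refine add_le_add h1 (h6.trans ?_)
        gcongr
        · exact h2.trans (by gcongr)
        · exact h3.trans (by gcongr)
    _ ≤ x * y + 2 * ((p * x) * hy + (y * q) * hx)
        + (x * hy + hx * y + hx * hy + 2 * (p * (x * y + hx * y + hx * hy)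
          + q * (x * y + x * hy + hx * hy))) := le_self_add
    _ = cP P * ((x + hx) * (y + hy)) := by rw [hc]; ring

theorem hs_sqrt_sq (a : ℝ≥0∞) : (a ^ (1 / 2 : ℝ)) ^ 2 = a := by
  rw [← ENNReal.rpow_natCast, ← ENNReal.rpow_mul]
  norm_num

theorem hs_sq_sqrt (a : ℝ≥0∞) : (a ^ 2) ^ (1 / 2 : ℝ) = a := by
  rw [← ENNReal.rpow_natCast, ← ENNReal.rpow_mul]
  norm_num

theorem nP_le (b : HilbertBasis ι ℂ K) (P A B : K →L[ℂ] K) :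
    nP b P (A - B) ≤ (dP b P A B) ^ 2 := by
  unfold nP dP
  rw [hsNorm_eq, ← enorm_eq_nnnorm]
  set h := hsSq b (P ∘L (A - B) ∘L (1 - P))
  conv_lhs => rw [← hs_sqrt_sq h]
  set k := h ^ (1 / 2 : ℝ)
  calc _ ≤ ‖A - B‖ₑ ^ 2 + k ^ 2 + 2 * ‖A - B‖ₑ * k := le_self_add
    _ = _ := by ring

theorem dP_le (b : HilbertBasis ι ℂ K) (P A B : K →L[ℂ] K) :
    dP b P A B ≤ 2 * (nP b P (A - B)) ^ (1 / 2 : ℝ) := by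
  unfold nP dP
  rw [hsNorm_eq, ← enorm_eq_nnnorm, two_mul]
  conv_lhs => rw [← hs_sq_sqrt ‖A - B‖ₑ]
  gcongr
  · exact le_self_add
  · exact le_add_self

theorem tendsto_dP_iff (b : HilbertBasis ι ℂ K) (P : K →L[ℂ] K) (A : ℕ → K →L[ℂ] K)
    (B : K →L[ℂ] K) :
    Tendsto (fun n => dP b P (A n) B) atTop (nhds 0) ↔
      Tendsto (fun n => nP b P (A n - B)) atTop (nhds 0) := by
  constructor
  · intro h
    have h2 := ENNReal.Tendsto.pow (n := 2) h
    rw [zero_pow two_ne_zero] at h2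
    exact tendsto_of_tendsto_of_tendsto_of_le_of_le tendsto_const_nhds h2
      (fun _ => zero_le) (fun n => nP_le b P _ _)
  · intro h
    have h2 := ENNReal.Tendsto.const_mul (a := 2) (h.ennrpow_const (1 / 2 : ℝ)) (by simp)
    rw [ENNReal.zero_rpow_of_pos (by norm_num), mul_zero] at h2
    exact tendsto_of_tendsto_of_tendsto_of_le_of_le tendsto_const_nhds h2
      (fun _ => zero_le) (fun n => dP_le b P _ _)

theorem nP_ne_top (b : HilbertBasis ι ℂ K) (P X : K →L[ℂ] K)
    (h : hsNorm b (P ∘L X ∘L (1 - P)) < ⊤) : nP b P X ≠ ⊤ := by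
  unfold nP
  have : hsSq b (P ∘L X ∘L (1 - P)) ≠ ⊤ := by
    intro h1
    rw [hsNorm_eq, h1] at h
    simp at h
  finiteness

theorem hsNorm_lt_top (b : HilbertBasis ι ℂ K) (P X : K →L[ℂ] K)
    (h : nP b P X ≠ ⊤) : hsNorm b (P ∘L X ∘L (1 - P)) < ⊤ := by
  unfold nP at h
  rw [hsNorm_eq]
  exact ENNReal.rpow_lt_top_of_nonneg (by norm_num) (fun h1 => h (by rw [h1, add_top]))

/-- The `J`-adjoint. -/
noncomputable def jAdj (P X : K →L[ℂ] K) : K →L[ℂ] K :=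
  (2 • P - 1) ∘L (ContinuousLinearMap.adjoint X) ∘L (2 • P - 1)

theorem hsSq_jAdj (b : HilbertBasis ι ℂ K)
    (P : K →L[ℂ] K) (hPidem : IsIdempotentElem P) (hPsa : IsSelfAdjoint P)
    (Γ : K →ₗ⋆[ℂ] K) (hΓΓ : ∀ f : K, Γ (Γ f) = f)
    (hΓinner : ∀ f g : K, ⟪Γ f, Γ g⟫_ℂ = ⟪g, f⟫_ℂ)
    (hΓP : ∀ f : K, Γ (P (Γ f)) = f - P f)
    (X : K →L[ℂ] K) (hX : ∀ f, X (Γ f) = Γ (X f)) :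
    hsSq b (P ∘L jAdj P X ∘L (1 - P)) = hsSq b (P ∘L X ∘L (1 - P)) := by
  have hPP : ∀ f, P (P f) = P f := fun f => congrArg (fun T : K →L[ℂ] K => T f) hPidem
  have hPa : ContinuousLinearMap.adjoint P = P := hPsa
  have e : P ∘L jAdj P X ∘L (1 - P)
      = -ContinuousLinearMap.adjoint ((1 - P) ∘L X ∘L P) := by
    have h1 : ContinuousLinearMap.adjoint (1 - P) = 1 - P := by
      rw [map_sub, hPa]
      congr 1
      exact star_one (K →L[ℂ] K)
    rw [ContinuousLinearMap.adjoint_comp, ContinuousLinearMap.adjoint_comp, h1, hPa]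
    ext f
    simp [jAdj, hPP, two_smul]
    abel
  rw [e, hsSq_neg, hsSq_adjoint]
  refine hsSq_conj b Γ hΓΓ hΓinner _ _ fun f => ?_
  have h2 : ∀ f, P (Γ f) = Γ (f - P f) := fun f => by rw [← hΓP f, hΓΓ]
  simp [h2, hX, hΓΓ]

theorem nP_jAdj (b : HilbertBasis ι ℂ K)
    (P : K →L[ℂ] K) (hPidem : IsIdempotentElem P) (hPsa : IsSelfAdjoint P)
    (Γ : K →ₗ⋆[ℂ] K) (hΓΓ : ∀ f : K, Γ (Γ f) = f)
    (hΓinner : ∀ f g : K, ⟪Γ f, Γ g⟫_ℂ = ⟪g, f⟫_ℂ)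
    (hΓP : ∀ f : K, Γ (P (Γ f)) = f - P f)
    (X : K →L[ℂ] K) (hX : ∀ f, X (Γ f) = Γ (X f)) :
    nP b P (jAdj P X) ≤ (‖(2 • P - 1 : K →L[ℂ] K)‖ₑ ^ 4 + 1) * nP b P X := by
  unfold nP
  rw [hsSq_jAdj b P hPidem hPsa Γ hΓΓ hΓinner hΓP X hX]
  set j := ‖(2 • P - 1 : K →L[ℂ] K)‖ₑ with hj
  have ha : ‖ContinuousLinearMap.adjoint X‖ₑ = ‖X‖ₑ := by
    simp [enorm_eq_nnnorm, ← NNReal.coe_inj]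
  have h1 : ‖jAdj P X‖ₑ ^ 2 ≤ j ^ 2 * (‖X‖ₑ ^ 2 * j ^ 2) := by
    refine (enorm_comp_sq _ _).trans ?_
    gcongr
    refine (enorm_comp_sq _ _).trans_eq ?_
    rw [ha]
  set h := hsSq b (P ∘L X ∘L (1 - P))
  calc _ ≤ j ^ 2 * (‖X‖ₑ ^ 2 * j ^ 2) + h := by gcongr
    _ ≤ j ^ 2 * (‖X‖ₑ ^ 2 * j ^ 2) + h + (j ^ 4 * h + ‖X‖ₑ ^ 2) := le_self_add
    _ = _ := by ring

theorem symm_eq_jAdj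
    (P : K →L[ℂ] K) (hPidem : IsIdempotentElem P)
    (U : K ≃L[ℂ] K)
    (h : ∀ f g : K, ⟪U f, (2 • P - 1 : K →L[ℂ] K) (U g)⟫_ℂ = ⟪f, (2 • P - 1 : K →L[ℂ] K) g⟫_ℂ) :
    (U.symm : K →L[ℂ] K) = jAdj P (U : K →L[ℂ] K) := by
  have hPP : ∀ f, P (P f) = P f := fun f => congrArg (fun T : K →L[ℂ] K => T f) hPidem
  have h1 : ∀ g, ContinuousLinearMap.adjoint (U : K →L[ℂ] K) ((2 • P - 1 : K →L[ℂ] K) (U g))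
      = (2 • P - 1 : K →L[ℂ] K) g := by
    intro g
    refine ext_inner_left ℂ fun f => ?_
    rw [ContinuousLinearMap.adjoint_inner_right]
    exact h f g
  have hJJ : ∀ g, (2 • P - 1 : K →L[ℂ] K) ((2 • P - 1 : K →L[ℂ] K) g) = g := by
    intro g
    simp [two_smul, hPP]
  ext f
  have h2 := h1 (U.symm f)
  rw [U.apply_symm_apply] at h2
  change U.symm f = (2 • P - 1 : K →L[ℂ] K)
    (ContinuousLinearMap.adjoint (U : K →L[ℂ] K) ((2 • P - 1 : K →L[ℂ] K) f))
  rw [h2, hJJ]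

end SpAux

/-- **`Sp(∞, P)` is a topological group for the metric `d_P`.**  It is closed under
products and inverses, and products and inverses are `d_P`-continuous. -/
theorem Sp_infty_P_topological_group
    {K : Type*} [NormedAddCommGroup K] [InnerProductSpace ℂ K] [CompleteSpace K]
    {ι : Type*} (b : HilbertBasis ι ℂ K)
    (P : K →L[ℂ] K) (hPidem : IsIdempotentElem P) (hPsa : IsSelfAdjoint P)
    (Γ : K →ₗ⋆[ℂ] K) (hΓΓ : ∀ f : K, Γ (Γ f) = f)
    (hΓinner : ∀ f g : K, ⟪Γ f, Γ g⟫_ℂ = ⟪g, f⟫_ℂ)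
    (hΓP : ∀ f : K, Γ (P (Γ f)) = f - P f) :
    (∀ U V : K ≃L[ℂ] K, InSp b P Γ U → InSp b P Γ V → InSp b P Γ (V.trans U)) ∧
    (∀ U : K ≃L[ℂ] K, InSp b P Γ U → InSp b P Γ U.symm) ∧
    (∀ (A : ℕ → K ≃L[ℂ] K) (A₀ : K ≃L[ℂ] K) (B : ℕ → K ≃L[ℂ] K) (B₀ : K ≃L[ℂ] K),
      (∀ n, InSp b P Γ (A n)) → InSp b P Γ A₀ →
      (∀ n, InSp b P Γ (B n)) → InSp b P Γ B₀ →
      Tendsto (fun n => dP b P ((A n : K →L[ℂ] K)) ((A₀ : K →L[ℂ] K))) atTop (nhds 0) →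
      Tendsto (fun n => dP b P ((B n : K →L[ℂ] K)) ((B₀ : K →L[ℂ] K))) atTop (nhds 0) →
      Tendsto (fun n => dP b P (((B n).trans (A n) : K ≃L[ℂ] K) : K →L[ℂ] K)
          (((B₀.trans A₀ : K ≃L[ℂ] K)) : K →L[ℂ] K)) atTop (nhds 0) ∧
      Tendsto (fun n => dP b P (((A n).symm : K ≃L[ℂ] K) : K →L[ℂ] K)
          ((A₀.symm : K ≃L[ℂ] K) : K →L[ℂ] K)) atTop (nhds 0)) := by
  have hsub : ∀ U V : K ≃L[ℂ] K, InSp b P Γ U → InSp b P Γ V →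
      ∀ f, ((U : K →L[ℂ] K) - V) (Γ f) = Γ (((U : K →L[ℂ] K) - V) f) := by
    intro U V hU hV f
    simp [hU.2.1, hV.2.1]
  refine ⟨?_, ?_, ?_⟩
  · intro U V hU hV
    refine ⟨fun f g => ?_, fun f => ?_, ?_⟩
    · exact (hU.1 (V f) (V g)).trans (hV.1 f g)
    · simp [hU.2.1, hV.2.1]
    · apply hsNorm_lt_top
      refine ne_top_of_le_ne_top ?_ (nP_mul b P hPidem (U : K →L[ℂ] K) (V : K →L[ℂ] K))
      exact ENNReal.mul_ne_top (cP_ne_top P)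
        (ENNReal.mul_ne_top (nP_ne_top b P _ hU.2.2) (nP_ne_top b P _ hV.2.2))
  · intro U hU
    refine ⟨fun f g => ?_, fun f => ?_, ?_⟩
    · have := hU.1 (U.symm f) (U.symm g)
      simpa only [U.apply_symm_apply] using this.symm
    · apply U.injective
      rw [hU.2.1]
      simp
    · apply hsNorm_lt_top
      rw [symm_eq_jAdj P hPidem U hU.1]
      refine ne_top_of_le_ne_top ?_ (nP_jAdj b P hPidem hPsa Γ hΓΓ hΓinner hΓP _ hU.2.1)
      exact ENNReal.mul_ne_top (by finiteness) (nP_ne_top b P _ hU.2.2)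
  · intro A A₀ B B₀ hA hA₀ hB hB₀ tA tB
    rw [tendsto_dP_iff] at tA tB
    rw [tendsto_dP_iff, tendsto_dP_iff]
    have nA := nP_ne_top b P _ hA₀.2.2
    have nB := nP_ne_top b P _ hB₀.2.2
    constructor
    · have hle : ∀ n, nP b P ((((B n).trans (A n) : K ≃L[ℂ] K) : K →L[ℂ] K)
          - (((B₀.trans A₀ : K ≃L[ℂ] K)) : K →L[ℂ] K)) ≤
          2 * (2 * (cP P * (nP b P ((A n : K →L[ℂ] K) - A₀) * nP b P ((B n : K →L[ℂ] K) - B₀))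
            + cP P * (nP b P (A₀ : K →L[ℂ] K) * nP b P ((B n : K →L[ℂ] K) - B₀)))
            + cP P * (nP b P ((A n : K →L[ℂ] K) - A₀) * nP b P (B₀ : K →L[ℂ] K))) := by
        intro n
        have e : (((B n).trans (A n) : K ≃L[ℂ] K) : K →L[ℂ] K)
          - (((B₀.trans A₀ : K ≃L[ℂ] K)) : K →L[ℂ] K) =
          (((A n : K →L[ℂ] K) - (A₀ : K →L[ℂ] K)) ∘L ((B n : K →L[ℂ] K) - (B₀ : K →L[ℂ] K))
            + (A₀ : K →L[ℂ] K) ∘L ((B n : K →L[ℂ] K) - (B₀ : K →L[ℂ] K)))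
            + ((A n : K →L[ℂ] K) - (A₀ : K →L[ℂ] K)) ∘L (B₀ : K →L[ℂ] K) := by
          ext f
          simp
          abel
        rw [e]
        refine (nP_add b P _ _).trans ?_
        gcongr
        · refine (nP_add b P _ _).trans ?_
          gcongr
          · exact nP_mul b P hPidem _ _
          · exact nP_mul b P hPidem _ _
        · exact nP_mul b P hPidem _ _
      have t1 := ENNReal.Tendsto.const_mul (a := cP P)
        (ENNReal.Tendsto.mul tA (Or.inr ENNReal.zero_ne_top) tB (Or.inr ENNReal.zero_ne_top))
        (Or.inr (cP_ne_top P))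
      have t2 := ENNReal.Tendsto.const_mul (a := cP P)
        (ENNReal.Tendsto.const_mul tB (Or.inr nA)) (Or.inr (cP_ne_top P))
      have t3 := ENNReal.Tendsto.const_mul (a := cP P)
        (ENNReal.Tendsto.mul_const tA (Or.inr nB)) (Or.inr (cP_ne_top P))
      have t4 := ENNReal.Tendsto.const_mul (a := 2)
        ((ENNReal.Tendsto.const_mul (a := 2) (t1.add t2) (Or.inr ENNReal.ofNat_ne_top)).add t3)
        (Or.inr ENNReal.ofNat_ne_top)
      simp only [mul_zero, zero_mul, add_zero] at t4
      exact tendsto_of_tendsto_of_tendsto_of_le_of_le tendsto_const_nhds t4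
        (fun _ => zero_le) hle
    · have hle : ∀ n, nP b P ((((A n).symm : K ≃L[ℂ] K) : K →L[ℂ] K)
          - ((A₀.symm : K ≃L[ℂ] K) : K →L[ℂ] K)) ≤
          (‖(2 • P - 1 : K →L[ℂ] K)‖ₑ ^ 4 + 1) * nP b P ((A n : K →L[ℂ] K) - A₀) := by
        intro n
        rw [symm_eq_jAdj P hPidem _ (hA n).1, symm_eq_jAdj P hPidem _ hA₀.1]
        have e : jAdj P (A n : K →L[ℂ] K) - jAdj P (A₀ : K →L[ℂ] K)
            = jAdj P ((A n : K →L[ℂ] K) - A₀) := by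
          unfold jAdj
          rw [map_sub]
          generalize (2 • P - 1 : K →L[ℂ] K) = J
          ext f
          simp
        rw [e]
        exact nP_jAdj b P hPidem hPsa Γ hΓΓ hΓinner hΓP _ (hsub _ _ (hA n) hA₀)
      have t1 := ENNReal.Tendsto.const_mul (a := ‖(2 • P - 1 : K →L[ℂ] K)‖ₑ ^ 4 + 1) tA
        (Or.inr (by finiteness))
      rw [mul_zero] at t1
      exact tendsto_of_tendsto_of_tendsto_of_le_of_le tendsto_const_nhds t1
        (fun _ => zero_le) hle
end

section
/- Let K be a complex Hilbert space, P an orthogonal projection on K, J := 2P − 1, and γ(f,g) := ⟨f, Jg⟩. Let U be a bounded invertible operator on K with γ(Uf, Ug) = γ(f,g) for all f, g ∈ K, and set U† := J U* J (the γ-adjoint) and P' := U P U†. Then: (i) U† U = U U† = 1; (ii) P U (1−P) U† P = (P − P')² P = −(P U(1−P)) (P U(1−P))*; and (iii) P U (1−P) is Hilbert–Schmidt if and only if (P − P')² P is trace class, in which case ‖P U (1−P)‖_HS² = −tr((P − P')² P). -/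
open scoped ENNReal InnerProductSpace

theorem parseval_aux {K : Type*} [NormedAddCommGroup K] [InnerProductSpace ℂ K] [CompleteSpace K]
    {ι : Type*} (b : HilbertBasis ι ℂ K) (x : K) :
    (‖x‖₊ : ℝ≥0∞) ^ 2 = ∑' j : ι, (‖⟪b j, x⟫_ℂ‖₊ : ℝ≥0∞) ^ 2 := by
  have h := b.hasSum_inner_mul_inner x x
  have h2 : HasSum (fun j => ‖⟪b j, x⟫_ℂ‖ ^ 2) (‖x‖ ^ 2) := by
    have h3 := Complex.hasSum_re h
    convert h3 using 1
    · ext j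
      rw [← inner_conj_symm x (b j), ← Complex.normSq_eq_conj_mul_self, Complex.ofReal_re,
        Complex.normSq_eq_norm_sq]
    · rw [inner_self_eq_norm_sq_to_K]
      norm_cast
  have h4 : HasSum (fun j => ‖⟪b j, x⟫_ℂ‖₊ ^ 2) (‖x‖₊ ^ 2) := by
    rw [← NNReal.hasSum_coe]
    simpa using h2
  have h5 := (ENNReal.hasSum_coe.mpr h4).tsum_eq
  simpa using h5.symm

theorem hs_adjoint_aux {K : Type*} [NormedAddCommGroup K] [InnerProductSpace ℂ K] [CompleteSpace K]
    {ι : Type*} (b : HilbertBasis ι ℂ K) (A : K →L[ℂ] K) :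
    (∑' i : ι, (‖A (b i)‖₊ : ℝ≥0∞) ^ 2) =
      ∑' i : ι, (‖ContinuousLinearMap.adjoint A (b i)‖₊ : ℝ≥0∞) ^ 2 := by
  simp_rw [parseval_aux b (A _), parseval_aux b (ContinuousLinearMap.adjoint A _)]
  rw [ENNReal.tsum_comm]
  refine tsum_congr fun i => tsum_congr fun j => ?_
  rw [ContinuousLinearMap.adjoint_inner_right]
  have : ‖⟪b i, A (b j)⟫_ℂ‖₊ = ‖⟪A (b j), b i⟫_ℂ‖₊ := by
    ext
    exact norm_inner_symm _ _
  rw [this]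

theorem ring_aux {R : Type*} [Ring R] (P J V W S Ud P' : R) (hP : P * P = P)
    (hJ : J = 2 • P - 1) (hVW : V * W = 1) (h : S * J * V = J)
    (hUd : Ud = J * (S * J)) (hP' : P' = V * (P * Ud)) :
    (Ud * V = 1 ∧ V * Ud = 1) ∧ P * (V * ((1 - P) * (Ud * P))) = (P - P') ^ 2 * P ∧
    (P - P') ^ 2 * P = -((P * (V * (1 - P))) * ((1 - P) * S * P)) := by
  have hJJ : J * J = 1 := by
    rw [hJ]; simp only [two_smul, mul_sub, sub_mul, add_mul, mul_add, hP, mul_one, one_mul]; abel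
  have hJP : J * P = P := by
    rw [hJ]; simp only [two_smul, mul_sub, sub_mul, add_mul, mul_add, hP, mul_one, one_mul]; abel
  have hQJ : (1 - P) * J = -(1 - P) := by
    rw [hJ]; simp only [two_smul, mul_sub, sub_mul, add_mul, mul_add, hP, mul_one, one_mul]; abel
  have hQ : (1 - P) * (1 - P) = 1 - P := by
    simp only [mul_sub, sub_mul, hP, mul_one, one_mul]; abel
  have h1 : Ud * V = 1 := by
    rw [hUd, mul_assoc, h, hJJ]
  have h2 : V * Ud = 1 := by
    have : Ud = W := by
      calc Ud = Ud * (V * W) := by rw [hVW, mul_one]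
        _ = W := by rw [← mul_assoc, h1, one_mul]
    rw [this, hVW]
  have hP'P' : P' * P' = P' := by
    calc P' * P' = V * (P * ((Ud * V) * (P * Ud))) := by rw [hP']; simp only [mul_assoc]
      _ = V * ((P * P) * Ud) := by rw [h1, one_mul, mul_assoc]
      _ = P' := by rw [hP, hP']
  have e1 : P * (V * ((1 - P) * (Ud * P))) = (P - P') ^ 2 * P := by
    have a1 : P * (V * ((1 - P) * (Ud * P))) = P * ((V * Ud - P') * P) := by
      rw [hP']; noncomm_ring
    have a2 : P * P' * P + P' * P * P = P * P' * P + P' * P := by rw [mul_assoc P' P P, hP]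
    rw [a1, h2, pow_two, sub_mul P P', mul_sub, mul_sub, hP, hP'P', sub_mul, one_mul, mul_sub, hP,
      sub_mul, sub_mul, sub_mul, mul_assoc P' P P, hP, mul_assoc]
    abel
  refine ⟨⟨h1, h2⟩, e1, ?_⟩
  rw [← e1, hUd]
  calc P * (V * ((1 - P) * (J * (S * J) * P)))
      = P * (V * (((1 - P) * J) * (S * (J * P)))) := by simp only [mul_assoc]
    _ = -(P * (V * (((1 - P) * (1 - P)) * (S * P)))) := by rw [hQJ, hJP, hQ]; noncomm_ring
    _ = _ := by simp only [mul_assoc]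

/-- **Properties of the `γ`-adjoint and of `P' = U P U†` for a symplectic `U`.**
With `J = 2P - 1`, `γ(f,g) = ⟪f, J g⟫`, `U` bounded invertible preserving `γ`,
`U† = J U* J` and `P' = U P U†`:
(i) `U† U = U U† = 1`;
(ii) `P U (1-P) U† P = (P - P')² P = -(P U (1-P)) (P U (1-P))*`;
(iii) `P U (1-P)` is Hilbert–Schmidt iff `(P - P')² P` is trace class, with
`‖P U (1-P)‖_HS² = -tr ((P - P')² P)` (expressed below as an equality in `[0,∞]`
between the squared Hilbert–Schmidt norm and the trace of `-(P - P')² P`). -/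
theorem symplectic_gamma_adjoint_properties
    {K : Type*} [NormedAddCommGroup K] [InnerProductSpace ℂ K] [CompleteSpace K]
    {ι : Type*} (b : HilbertBasis ι ℂ K)
    (P : K →L[ℂ] K) (hPidem : IsIdempotentElem P) (hPsa : IsSelfAdjoint P)
    (J : K →L[ℂ] K) (hJ : J = 2 • P - 1)
    (U : K ≃L[ℂ] K)
    (hpres : ∀ f g : K, ⟪U f, J (U g)⟫_ℂ = ⟪f, J g⟫_ℂ)
    (Ud : K →L[ℂ] K)
    (hUd : Ud = J ∘L ContinuousLinearMap.adjoint (U : K →L[ℂ] K) ∘L J)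
    (P' : K →L[ℂ] K) (hP' : P' = (U : K →L[ℂ] K) ∘L P ∘L Ud) :
    (Ud ∘L (U : K →L[ℂ] K) = 1 ∧ (U : K →L[ℂ] K) ∘L Ud = 1) ∧
    (P ∘L (U : K →L[ℂ] K) ∘L (1 - P) ∘L Ud ∘L P = ((P - P') ^ 2) ∘L P ∧
      ((P - P') ^ 2) ∘L P =
        -((P ∘L (U : K →L[ℂ] K) ∘L (1 - P)) ∘L
            ContinuousLinearMap.adjoint (P ∘L (U : K →L[ℂ] K) ∘L (1 - P)))) ∧
    (∑' i : ι, (‖(P ∘L (U : K →L[ℂ] K) ∘L (1 - P)) (b i)‖₊ : ℝ≥0∞) ^ 2)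
      = ∑' i : ι, ENNReal.ofReal (⟪b i, (-(((P - P') ^ 2) ∘L P)) (b i)⟫_ℂ).re := by
  have hVW : (U : K →L[ℂ] K) * (U.symm : K →L[ℂ] K) = 1 := by
    ext x; simp
  have hS : ContinuousLinearMap.adjoint (U : K →L[ℂ] K) * J * (U : K →L[ℂ] K) = J := by
    ext g
    refine ext_inner_left ℂ fun f => ?_
    rw [← hpres f g]
    simp [ContinuousLinearMap.adjoint_inner_right]
  obtain ⟨h1, h2, h3⟩ := ring_aux P J (U : K →L[ℂ] K) (U.symm : K →L[ℂ] K)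
    (ContinuousLinearMap.adjoint (U : K →L[ℂ] K)) Ud P' hPidem hJ hVW hS hUd hP'
  have hadj : ContinuousLinearMap.adjoint (P ∘L (U : K →L[ℂ] K) ∘L (1 - P)) =
      (1 - P) * ContinuousLinearMap.adjoint (U : K →L[ℂ] K) * P := by
    change star (P * ((U : K →L[ℂ] K) * (1 - P))) = (1 - P) * star (U : K →L[ℂ] K) * P
    rw [star_mul, star_mul, star_sub, star_one, hPsa.star_eq]
  have h4 : ((P - P') ^ 2) ∘L P =
        -((P ∘L (U : K →L[ℂ] K) ∘L (1 - P)) ∘L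
            ContinuousLinearMap.adjoint (P ∘L (U : K →L[ℂ] K) ∘L (1 - P))) := by
    rw [hadj]; exact h3
  refine ⟨h1, ⟨h2, h4⟩, ?_⟩
  rw [h4, neg_neg, hs_adjoint_aux]
  generalize P ∘L (U : K →L[ℂ] K) ∘L (1 - P) = A
  refine tsum_congr fun i => ?_
  rw [ContinuousLinearMap.comp_apply, ← ContinuousLinearMap.adjoint_inner_left,
    inner_self_eq_norm_sq_to_K]
  have : (((‖ContinuousLinearMap.adjoint A (b i)‖ : ℂ)) ^ 2).re
      = ‖ContinuousLinearMap.adjoint A (b i)‖ ^ 2 := by norm_cast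
  erw [this]
  rw [ENNReal.ofReal_pow (norm_nonneg _), ofReal_norm]
  rfl
end

section
/- Let K be a complex Hilbert space, Γ an antiunitary involution on K, P an orthogonal projection on K with ΓPΓ = 1 − P, J := 2P − 1, and γ(f,g) := ⟨f, Jg⟩. Let U be a bounded invertible operator on K with γ(Uf, Ug) = γ(f,g) for all f, g ∈ K and U∘Γ = Γ∘U. Then ‖P U⁻¹ (1−P)‖_HS = ‖P U (1−P)‖_HS (as an equality in [0,∞]); in particular P U⁻¹ (1−P) is Hilbert–Schmidt if and only if P U (1−P) is. -/
open scoped ENNReal InnerProductSpace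

theorem parseval_enn {K : Type*} [NormedAddCommGroup K] [InnerProductSpace ℂ K]
    [CompleteSpace K] {ι : Type*} (b : HilbertBasis ι ℂ K) (x : K) :
    ∑' i : ι, (‖⟪b i, x⟫_ℂ‖₊ : ℝ≥0∞) ^ 2 = (‖x‖₊ : ℝ≥0∞) ^ 2 := by
  have h := b.hasSum_inner_mul_inner x x
  have h2 : HasSum (fun i => ‖⟪b i, x⟫_ℂ‖ ^ 2) (‖x‖ ^ 2) := by
    have h3 := (Complex.reCLM.hasSum h)
    have e1 : Complex.reCLM ⟪x, x⟫_ℂ = ‖x‖ ^ 2 := by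
      rw [inner_self_eq_norm_sq_to_K]
      simp [← Complex.ofReal_pow]
    rw [e1] at h3
    convert h3 using 2 with i
    rw [← inner_conj_symm x (b i)]
    rw [RCLike.conj_mul]
    simp [← Complex.ofReal_pow]
  have h4 : HasSum (fun i => ‖⟪b i, x⟫_ℂ‖₊ ^ 2) (‖x‖₊ ^ 2) := by
    rw [← NNReal.hasSum_coe]
    simpa using h2
  have h5 := (ENNReal.hasSum_coe.2 h4).tsum_eq
  simpa using h5

theorem sum_swap {K : Type*} [NormedAddCommGroup K] [InnerProductSpace ℂ K]
    [CompleteSpace K] {ι : Type*} (b : HilbertBasis ι ℂ K) (A B : K → K)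
    (h : ∀ i j, ‖⟪b j, A (b i)⟫_ℂ‖ = ‖⟪b i, B (b j)⟫_ℂ‖) :
    ∑' i : ι, (‖A (b i)‖₊ : ℝ≥0∞) ^ 2 = ∑' i : ι, (‖B (b i)‖₊ : ℝ≥0∞) ^ 2 := by
  have hh : ∀ i j, ‖⟪b j, A (b i)⟫_ℂ‖₊ = ‖⟪b i, B (b j)⟫_ℂ‖₊ := fun i j => NNReal.eq (h i j)
  calc _ = ∑' i, ∑' j, (‖⟪b j, A (b i)⟫_ℂ‖₊ : ℝ≥0∞) ^ 2 := by simp_rw [parseval_enn]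
    _ = ∑' j, ∑' i, (‖⟪b j, A (b i)⟫_ℂ‖₊ : ℝ≥0∞) ^ 2 := ENNReal.tsum_comm
    _ = _ := by simp_rw [hh, parseval_enn]

/-- **`‖P U⁻¹ (1-P)‖_HS = ‖P U (1-P)‖_HS` for a symplectic `U` commuting with `Γ`.**
Here `Γ` is an antiunitary involution, `P` an orthogonal projection with `Γ P Γ = 1-P`,
`J = 2P - 1`, `γ(f,g) = ⟪f, J g⟫`, and `U` is a bounded invertible operator preserving
`γ` and commuting with `Γ`. -/
theorem hsNorm_offdiag_inv_eq
    {K : Type*} [NormedAddCommGroup K] [InnerProductSpace ℂ K] [CompleteSpace K]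
    {ι : Type*} (b : HilbertBasis ι ℂ K)
    (Γ : K →ₗ⋆[ℂ] K) (hΓΓ : ∀ f : K, Γ (Γ f) = f)
    (hΓinner : ∀ f g : K, ⟪Γ f, Γ g⟫_ℂ = ⟪g, f⟫_ℂ)
    (P : K →L[ℂ] K) (hPidem : IsIdempotentElem P) (hPsa : IsSelfAdjoint P)
    (hΓP : ∀ f : K, Γ (P (Γ f)) = f - P f)
    (J : K →L[ℂ] K) (hJ : J = 2 • P - 1)
    (U : K ≃L[ℂ] K)
    (hpres : ∀ f g : K, ⟪U f, J (U g)⟫_ℂ = ⟪f, J g⟫_ℂ)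
    (hUΓ : ∀ f : K, U (Γ f) = Γ (U f)) :
    hsNorm b (P ∘L (U.symm : K →L[ℂ] K) ∘L (1 - P))
      = hsNorm b (P ∘L (U : K →L[ℂ] K) ∘L (1 - P)) := by
  have hPP : ∀ x, P (P x) = P x := fun x => by
    have := congrArg (fun T : K →L[ℂ] K => T x) hPidem
    simpa using this
  have hPs : ∀ x y, ⟪P x, y⟫_ℂ = ⟪x, P y⟫_ℂ := fun x y => hPsa.isSymmetric x y
  have hJx : ∀ x, J x = P x + P x - x := fun x => by simp [hJ, two_smul]
  have hJs : ∀ x y, ⟪J x, y⟫_ℂ = ⟪x, J y⟫_ℂ := fun x y => by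
    simp only [hJx, inner_sub_left, inner_add_left, inner_sub_right, inner_add_right, hPs]
  have hΓn : ∀ x, ‖Γ x‖ = ‖x‖ := fun x => by
    rw [@norm_eq_sqrt_re_inner ℂ, @norm_eq_sqrt_re_inner ℂ, hΓinner]
  have hPG : ∀ x, P (Γ x) = Γ (x - P x) := fun x => by rw [← hΓP, hΓΓ]
  set T : K →L[ℂ] K := P ∘L (U : K →L[ℂ] K) ∘L (1 - P) with hT
  have hTx : ∀ x, T x = P (U (x - P x)) := fun x => by simp [hT]
  let S : K → K := fun x => U (P x) - P (U (P x))
  have hS : ∀ x, S x = Γ (T (Γ x)) := fun x => by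
    have e : Γ x - P (Γ x) = Γ (P x) := by rw [hPG]; simp
    rw [hTx, e, hUΓ, hΓP]
  unfold hsNorm
  congr 1
  have s1 := sum_swap b (fun x => (P ∘L (U.symm : K →L[ℂ] K) ∘L (1 - P)) x) S (by
    intro i j
    rw [norm_inner_symm (b i)]
    have e0 : J (P (b j)) = P (b j) := by rw [hJx, hPP]; abel
    have e1 : J (b i - P (b i)) = -(b i - P (b i)) := by
      rw [hJx, map_sub, hPP]; abel
    have : ⟪b j, (P ∘L (U.symm : K →L[ℂ] K) ∘L (1 - P)) (b i)⟫_ℂ = - ⟪S (b j), b i⟫_ℂ := by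
      have e2 : (P ∘L (U.symm : K →L[ℂ] K) ∘L (1 - P)) (b i) = P (U.symm (b i - P (b i))) := by
        simp
      rw [e2, ← hPs, ← e0, hJs, ← hpres, U.apply_symm_apply, e1, inner_neg_right]
      simp only [S, inner_sub_left, inner_sub_right, hPs]
    rw [this, norm_neg])
  have s2 := sum_swap b (fun x => T (Γ x)) (fun x => Γ (T.adjoint x)) (by
    intro i j
    rw [← ContinuousLinearMap.adjoint_inner_left, ← hΓinner, hΓΓ])
  have s3 := sum_swap b (fun x => T.adjoint x) (fun x => T x) (by
    intro i j
    rw [ContinuousLinearMap.adjoint_inner_right, norm_inner_symm])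
  have hΓnn : ∀ x, ‖Γ x‖₊ = ‖x‖₊ := fun x => NNReal.eq (hΓn x)
  simp only [hS, hΓnn] at s1 s2 s3
  exact s1.trans (s2.trans s3)
end
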